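/- Let σ > 1, δ > 0, and let a be a symbol of order 0 with constants (C_n). There exists a constant C such that for every integer k ≥ 1, all r₁, r₂ > 0 with 3/4 ≤ r₁ + r₂ ≤ 8/3 and 2^k r₁ r₂ ≥ 1, and every β ∈ [−π, π], writing d_s = d_s(r₁,r₂): (i) | ∫_0^{2σ} e^{i 2^k d_s} a(2^k d_s) (1 + 2^k d_s)^{-(3/2+δ)} [ sin(β/σ)/(cosh(s/σ) − cos(β/σ)) − 2σβ/(s² + β²) ] ds | ≤ C (1 + 2^k r₁ r₂)^{-1/2}; and (ii) | ∫_0^{2σ} e^{i 2^k d_s} [ a(2^k d_s)(1 + 2^k d_s)^{-(3/2+δ)} − a(2^k(r₁+r₂))(1 + 2^k(r₁+r₂))^{-(3/2+δ)} ] · 2σβ/(s² + β²) ds | ≤ C (1 + 2^k r₁ r₂)^{-1/2}. -/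

import Mathlib

open MeasureTheory Real Set
open scoped ENNReal NNReal

noncomputable section

/-- The measure `r dr` on `(0,∞)`. -/
def radialMeasure : Measure ℝ :=
  (volume.restrict (Set.Ioi (0:ℝ))).withDensity fun r => ENNReal.ofReal r

/-- The measure `r dr dθ` on the flat cone `X = (0,∞) × [0, 2πσ)`. -/
def coneMeasure (σ : ℝ) : Measure (ℝ × ℝ) :=
  radialMeasure.prod (volume.restrict (Set.Ico (0:ℝ) (2*π*σ)))

/-- The integral operator on the flat cone associated with a kernel `K`. -/
def coneOp (σ : ℝ) (K : ℝ → ℝ → ℝ → ℝ → ℂ) (f : ℝ × ℝ → ℂ) : ℝ × ℝ → ℂ :=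
  fun x => ∫ θ₂ in Set.Ico (0:ℝ) (2*π*σ), ∫ r₂ in Set.Ioi (0:ℝ),
    K x.1 x.2 r₂ θ₂ * f (r₂, θ₂) * (r₂:ℂ)

/-- The critical Bochner–Riesz exponent `δ_c(p,2) = max {0, 2|1/2 − 1/p| − 1/2}`. -/
def deltaC (p : ℝ≥0∞) : ℝ := max 0 (2 * |1/2 - (1/p).toReal| - 1/2)

/-- `d_j(r₁,r₂,θ) = sqrt(r₁² + r₂² − 2 r₁ r₂ cos(θ + 2jσπ))`. -/
def dj (σ : ℝ) (j : ℤ) (r₁ r₂ θ : ℝ) : ℝ :=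
  Real.sqrt (r₁^2 + r₂^2 - 2*r₁*r₂*Real.cos (θ + 2*(j:ℝ)*σ*π))

/-- `d_s(r₁,r₂) = sqrt(r₁² + r₂² + 2 r₁ r₂ cosh s)`. -/
def dsc (s r₁ r₂ : ℝ) : ℝ := Real.sqrt (r₁^2 + r₂^2 + 2*r₁*r₂*Real.cosh s)

/-- The diffractive density `A_σ(s,θ)`. -/
def Asig (σ s θ : ℝ) : ℝ :=
  (1/2) * (Real.sin ((π - θ)/σ) / (Real.cosh (s/σ) - Real.cos ((π - θ)/σ)))
  + (1/2) * (Real.sin ((π + θ)/σ) / (Real.cosh (s/σ) - Real.cos ((π + θ)/σ)))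

/-- A symbol of order `0` with constants `Cn`: smooth on `(0,∞)` with
`|a^{(n)}(r)| ≤ Cn n (1+r)^{-n}`. -/
def IsSymbol0 (a : ℝ → ℂ) (Cn : ℕ → ℝ) : Prop :=
  ContDiffOn ℝ (⊤ : ℕ∞) a (Set.Ioi 0) ∧
  ∀ n : ℕ, ∀ r : ℝ, 0 < r →
    ‖iteratedDerivWithin n a (Set.Ioi 0) r‖ ≤ Cn n * (1 + r) ^ (-(n:ℝ))

/-- Littlewood–Paley-type pieces: `ψ_k = ψ(2^{-k}·)` for `k ≥ 1` and
`ψ₀ = 1 − Σ_{m≥1} ψ(2^{-m}·)` for `k = 0`. -/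
def psiK (ψ : ℝ → ℝ) (k : ℕ) (r : ℝ) : ℝ :=
  if k = 0 then 1 - ∑' m : ℕ, ψ (r / 2^(m+1)) else ψ (r / 2^k)

theorem intervalIntegrable_poisson (β S T : ℝ) :
    IntervalIntegrable (fun s => |β| / (s ^ 2 + β ^ 2)) volume S T := by
  rcases eq_or_ne β 0 with rfl | hβ
  · simp
  · exact (continuous_const.div (by fun_prop) fun s => by positivity).intervalIntegrable _ _

theorem integral_poisson_le (β T : ℝ) :
    ∫ s in (0:ℝ)..T, |β| / (s ^ 2 + β ^ 2) ≤ π / 2 := by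
  rcases eq_or_ne β 0 with rfl | hβ
  · simpa using Real.pi_div_two_pos.le
  have hb : 0 < |β| := abs_pos.mpr hβ
  have hderiv : ∀ s ∈ Set.uIcc 0 T,
      HasDerivAt (fun s => Real.arctan (s / |β|)) (|β| / (s ^ 2 + β ^ 2)) s := by
    intro s _
    have h := ((hasDerivAt_id s).div_const |β|).arctan
    refine h.congr_deriv ?_
    rw [← sq_abs β, id]
    field_simp
    ring
  rw [intervalIntegral.integral_eq_sub_of_hasDerivAt hderiv
    (intervalIntegrable_poisson β 0 T)]
  simpa using (Real.arctan_lt_pi_div_two (T / |β|)).le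

theorem norm_integral_le_of_norm_le_poisson {f : ℝ → ℂ} {A β T : ℝ} (hA : 0 ≤ A) (hT : 0 ≤ T)
    (hf : ∀ s ∈ Set.Ioc 0 T, ‖f s‖ ≤ A * (|β| / (s ^ 2 + β ^ 2))) :
    ‖∫ s in (0:ℝ)..T, f s‖ ≤ A * (π / 2) :=
  calc ‖∫ s in (0:ℝ)..T, f s‖ ≤ ∫ s in (0:ℝ)..T, A * (|β| / (s ^ 2 + β ^ 2)) :=
        intervalIntegral.norm_integral_le_of_norm_le hT (Filter.Eventually.of_forall hf)
          ((intervalIntegrable_poisson β 0 T).const_mul A)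
    _ = A * ∫ s in (0:ℝ)..T, |β| / (s ^ 2 + β ^ 2) := intervalIntegral.integral_const_mul ..
    _ ≤ A * (π / 2) := mul_le_mul_of_nonneg_left (integral_poisson_le β T) hA

theorem one_add_sq_div_two_le_cosh {t : ℝ} (ht : 0 ≤ t) : 1 + t ^ 2 / 2 ≤ Real.cosh t := by
  have hsinh : t / 2 ≤ Real.sinh (t / 2) := Real.self_le_sinh_iff.mpr (by linarith)
  have hcosh := Real.cosh_two_mul (t / 2)
  rw [mul_div_cancel₀ t two_ne_zero, Real.cosh_sq] at hcosh
  nlinarith [pow_le_pow_left₀ (by linarith) hsinh 2]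

theorem abs_sin_div_cosh_sub_cos_le {σ : ℝ} (hσ : 1 < σ) {s β : ℝ} (hs : 0 < s)
    (hβ : |β| ≤ π) :
    |Real.sin (β / σ) / (Real.cosh (s / σ) - Real.cos (β / σ))|
      ≤ π ^ 2 / 2 * σ * (|β| / (s ^ 2 + β ^ 2)) := by
  have hσ0 : 0 < σ := by linarith
  have hbσ : |β / σ| ≤ π := by
    rw [abs_div, abs_of_pos hσ0]
    exact (div_le_self (abs_nonneg β) hσ.le).trans hβ
  have hcos := Real.cos_le_one_sub_mul_cos_sq hbσ
  have hcosh : 1 + (s / σ) ^ 2 / 2 ≤ Real.cosh (s / σ) :=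
    one_add_sq_div_two_le_cosh (by positivity)
  have hpi : 2 / π ^ 2 ≤ 1 / 2 := by
    rw [div_le_div_iff₀ (by positivity) (by norm_num)]
    nlinarith [Real.pi_gt_three]
  have hpos : 0 < 2 / π ^ 2 * ((s / σ) ^ 2 + (β / σ) ^ 2) := by positivity
  have hlow : 2 / π ^ 2 * ((s / σ) ^ 2 + (β / σ) ^ 2)
      ≤ Real.cosh (s / σ) - Real.cos (β / σ) := by
    nlinarith [sq_nonneg (s / σ)]
  rw [abs_div, abs_of_pos (hpos.trans_le hlow)]
  calc |Real.sin (β / σ)| / (Real.cosh (s / σ) - Real.cos (β / σ))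
      ≤ |β / σ| / (2 / π ^ 2 * ((s / σ) ^ 2 + (β / σ) ^ 2)) :=
        div_le_div₀ (abs_nonneg _) Real.abs_sin_le_abs hpos hlow
    _ = π ^ 2 / 2 * σ * (|β| / (s ^ 2 + β ^ 2)) := by
        rw [abs_div, abs_of_pos hσ0]
        field_simp

theorem abs_two_mul_div_eq {σ : ℝ} (hσ : 0 < σ) (s β : ℝ) :
    |2 * σ * β / (s ^ 2 + β ^ 2)| = 2 * σ * (|β| / (s ^ 2 + β ^ 2)) := by
  rw [abs_div, abs_mul, abs_of_pos (by positivity : 0 < 2 * σ),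
    abs_of_nonneg (by positivity : 0 ≤ s ^ 2 + β ^ 2), mul_div_assoc]

theorem add_le_dsc {r₁ r₂ : ℝ} (h₁ : 0 < r₁) (h₂ : 0 < r₂) (s : ℝ) :
    r₁ + r₂ ≤ dsc s r₁ r₂ := by
  apply Real.le_sqrt_of_sq_le
  nlinarith [mul_le_mul_of_nonneg_left (Real.one_le_cosh s) (mul_pos h₁ h₂).le]

theorem IsSymbol0.norm_le {a : ℝ → ℂ} {Cn : ℕ → ℝ} (ha : IsSymbol0 a Cn) {r : ℝ} (hr : 0 < r) :
    ‖a r‖ ≤ Cn 0 := by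
  simpa using ha.2 0 r hr

theorem IsSymbol0.norm_mul_rpow_le {a : ℝ → ℂ} {Cn : ℕ → ℝ} (ha : IsSymbol0 a Cn) {δ : ℝ}
    (hδ : 0 < δ) {x y : ℝ} (hx : 0 < x) (hxy : x ≤ y) :
    ‖a y * (((1 + y) ^ (-(3/2 + δ)) : ℝ) : ℂ)‖ ≤ Cn 0 * (1 + x) ^ (-(1/2) : ℝ) := by
  have hy : 0 < y := hx.trans_le hxy
  rw [norm_mul, Complex.norm_of_nonneg (by positivity)]
  have hC : 0 ≤ Cn 0 := (norm_nonneg _).trans (ha.norm_le hy)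
  refine mul_le_mul (ha.norm_le hy) ?_ (by positivity) hC
  calc (1 + y) ^ (-(3/2 + δ)) ≤ (1 + y) ^ (-(1/2) : ℝ) :=
        Real.rpow_le_rpow_of_exponent_le (by linarith) (by linarith)
    _ ≤ (1 + x) ^ (-(1/2) : ℝ) :=
        Real.rpow_le_rpow_of_nonpos (by linarith) (by linarith) (by norm_num)

/-- the two small-`s` oscillatory-integral bounds for the diffractive term. -/
theorem diffractive_small_s_bounds (σ δ : ℝ) (hσ : 1 < σ) (hδ : 0 < δ)
    (a : ℝ → ℂ) (Cn : ℕ → ℝ) (ha : IsSymbol0 a Cn) :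
    ∃ C : ℝ, 0 < C ∧ ∀ k : ℕ, 1 ≤ k → ∀ r₁ r₂ : ℝ, 0 < r₁ → 0 < r₂ →
      3/4 ≤ r₁ + r₂ → r₁ + r₂ ≤ 8/3 → 1 ≤ 2^k * r₁ * r₂ →
      ∀ β : ℝ, β ∈ Set.Icc (-π) π →
      (‖∫ s in (0:ℝ)..(2*σ),
          Complex.exp (Complex.I * (((2:ℝ)^k * dsc s r₁ r₂ : ℝ) : ℂ)) *
            a ((2:ℝ)^k * dsc s r₁ r₂) *
            (((1 + (2:ℝ)^k * dsc s r₁ r₂) ^ (-(3/2 + δ)) : ℝ) : ℂ) *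
            ((Real.sin (β/σ) / (Real.cosh (s/σ) - Real.cos (β/σ))
                - 2*σ*β / (s^2 + β^2) : ℝ) : ℂ)‖
        ≤ C * (1 + 2^k * r₁ * r₂) ^ (-(1/2) : ℝ)) ∧
      (‖∫ s in (0:ℝ)..(2*σ),
          Complex.exp (Complex.I * (((2:ℝ)^k * dsc s r₁ r₂ : ℝ) : ℂ)) *
            (a ((2:ℝ)^k * dsc s r₁ r₂) *
                (((1 + (2:ℝ)^k * dsc s r₁ r₂) ^ (-(3/2 + δ)) : ℝ) : ℂ)
              - a ((2:ℝ)^k * (r₁ + r₂)) *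
                (((1 + (2:ℝ)^k * (r₁ + r₂)) ^ (-(3/2 + δ)) : ℝ) : ℂ)) *
            ((2*σ*β / (s^2 + β^2) : ℝ) : ℂ)‖
        ≤ C * (1 + 2^k * r₁ * r₂) ^ (-(1/2) : ℝ)) := by
  have hσ0 : 0 < σ := by linarith
  have hC0 : 0 ≤ Cn 0 := (norm_nonneg _).trans (ha.norm_le one_pos)
  set M : ℝ := π ^ 2 / 2 * σ + 4 * σ with hM
  have hM0 : 0 < M := by positivity
  refine ⟨(Cn 0 + 1) * M * (π / 2), by positivity, ?_⟩
  intro k _ r₁ r₂ h₁ h₂ _ hle _ β hβ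
  have hβ' : |β| ≤ π := abs_le.mpr hβ
  set W : ℝ := (1 + 2 ^ k * r₁ * r₂) ^ (-(1/2) : ℝ) with hW
  have hW0 : 0 ≤ W := by positivity
  have hx : 0 < 2 ^ k * r₁ * r₂ := by positivity
  have hprod : r₁ * r₂ ≤ r₁ + r₂ := by nlinarith [sq_nonneg (r₁ - r₂)]
  have hsum : 2 ^ k * r₁ * r₂ ≤ 2 ^ k * (r₁ + r₂) := by
    rw [mul_assoc]
    exact mul_le_mul_of_nonneg_left hprod (by positivity)
  have hdsc (s : ℝ) : 2 ^ k * r₁ * r₂ ≤ 2 ^ k * dsc s r₁ r₂ :=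
    hsum.trans (mul_le_mul_of_nonneg_left (add_le_dsc h₁ h₂ s) (by positivity))
  have hexp (x : ℝ) : ‖Complex.exp (Complex.I * (x : ℂ))‖ = 1 := Complex.norm_exp_I_mul_ofReal x
  have hamp {y : ℝ} (hy : 2 ^ k * r₁ * r₂ ≤ y) := ha.norm_mul_rpow_le hδ hx hy
  have hbound {f : ℝ → ℂ}
      (hf : ∀ s ∈ Set.Ioc 0 (2 * σ), ‖f s‖ ≤ Cn 0 * W * (M * (|β| / (s ^ 2 + β ^ 2)))) :
      ‖∫ s in (0:ℝ)..(2*σ), f s‖ ≤ (Cn 0 + 1) * M * (π / 2) * W :=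
    calc ‖∫ s in (0:ℝ)..(2*σ), f s‖ ≤ Cn 0 * W * M * (π / 2) :=
          norm_integral_le_of_norm_le_poisson (by positivity) (by positivity)
            fun s hs => (hf s hs).trans_eq (mul_assoc _ _ _).symm
      _ ≤ (Cn 0 + 1) * W * M * (π / 2) := by gcongr; linarith
      _ = (Cn 0 + 1) * M * (π / 2) * W := by ring
  constructor
  · refine hbound fun s hs => ?_
    rw [norm_mul, mul_assoc (Complex.exp _), norm_mul, hexp, one_mul, Complex.norm_real,
      Real.norm_eq_abs]
    refine mul_le_mul (hamp (hdsc s)) ?_ (abs_nonneg _) (by positivity)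
    refine (abs_sub _ _).trans ?_
    have hP : 0 ≤ σ * (|β| / (s ^ 2 + β ^ 2)) := by positivity
    rw [abs_two_mul_div_eq hσ0, hM]
    linarith [abs_sin_div_cosh_sub_cos_le hσ hs.1 hβ']
  · refine hbound fun s _ => ?_
    rw [norm_mul, norm_mul, hexp, one_mul, Complex.norm_real, Real.norm_eq_abs,
      abs_two_mul_div_eq hσ0]
    have hdiff := (norm_sub_le _ _).trans (add_le_add (hamp (hdsc s)) (hamp hsum))
    calc _ ≤ (Cn 0 * W + Cn 0 * W) * (2 * σ * (|β| / (s ^ 2 + β ^ 2))) := by gcongr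
      _ = Cn 0 * W * (4 * σ * (|β| / (s ^ 2 + β ^ 2))) := by ring
      _ ≤ Cn 0 * W * (M * (|β| / (s ^ 2 + β ^ 2))) := by
          gcongr
          rw [hM]
          linarith [show 0 ≤ π ^ 2 / 2 * σ by positivity]
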